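/- arXiv:2203.04188 — 3 statements merged into one kernel-verified Lean document; each statement's English description precedes it below -/
import Mathlib

section
/- Suppose α, β > 0 and α(‖P‖ + β‖H‖²) < 1. Then the (n+m)×(n+m) block matrix M = [[(1/α)Iₙ − P, −Hᵀ], [−H, (1/β)Iₘ]] is symmetric and positive definite. -/
open Matrix

/-- Spectral norm (largest singular value) of a real matrix,
as the operator norm of the induced map between Euclidean spaces. -/
noncomputable def specNorm {ι κ : Type*} [Fintype ι] [Fintype κ] [DecidableEq κ]
    (A : Matrix ι κ ℝ) : ℝ :=
  ‖LinearMap.toContinuousLinearMap (Matrix.toEuclideanLin A)‖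

/-- The bilinear form of a real matrix is bounded by its spectral norm. -/
lemma dotProduct_mulVec_le_specNorm {ι κ : Type*} [Fintype ι] [Fintype κ] [DecidableEq κ]
    (A : Matrix ι κ ℝ) (y : ι → ℝ) (x : κ → ℝ) :
    y ⬝ᵥ (A *ᵥ x) ≤ specNorm A * ‖WithLp.toLp 2 x‖ * ‖WithLp.toLp 2 y‖ := by
  have h₁ := real_inner_le_norm (WithLp.toLp 2 (A *ᵥ x)) (WithLp.toLp 2 y)
  have h₂ := (LinearMap.toContinuousLinearMap (Matrix.toEuclideanLin A)).le_opNorm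
    (WithLp.toLp 2 x)
  rw [EuclideanSpace.inner_toLp_toLp, star_trivial] at h₁
  exact h₁.trans (mul_le_mul_of_nonneg_right h₂ (norm_nonneg _))

lemma dotProduct_self_eq_norm_sq {ι : Type*} [Fintype ι] (x : ι → ℝ) :
    x ⬝ᵥ x = ‖WithLp.toLp 2 x‖ ^ 2 := by
  rw [EuclideanSpace.real_norm_sq_eq]
  simp [dotProduct, sq]

/-- If `P` is symmetric positive semidefinite, `α, β > 0` and
`α (‖P‖ + β ‖H‖²) < 1`, then the block matrix
`M = [[(1/α) Iₙ − P, −Hᵀ], [−H, (1/β) Iₘ]]` is symmetric and positive definite. -/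
theorem stmt0 {n m : ℕ} (P : Matrix (Fin n) (Fin n) ℝ) (H : Matrix (Fin m) (Fin n) ℝ)
    (hP : P.PosSemidef) (α β : ℝ) (hα : 0 < α) (hβ : 0 < β)
    (hstep : α * (specNorm P + β * specNorm H ^ 2) < 1) :
    (Matrix.fromBlocks ((1/α) • (1 : Matrix (Fin n) (Fin n) ℝ) - P) (-Hᵀ) (-H)
        ((1/β) • (1 : Matrix (Fin m) (Fin m) ℝ))).IsSymm ∧
    (Matrix.fromBlocks ((1/α) • (1 : Matrix (Fin n) (Fin n) ℝ) - P) (-Hᵀ) (-H)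
        ((1/β) • (1 : Matrix (Fin m) (Fin m) ℝ))).PosDef := by
  have hH : (Matrix.fromBlocks ((1/α) • (1 : Matrix (Fin n) (Fin n) ℝ) - P) (-Hᵀ) (-H)
      ((1/β) • (1 : Matrix (Fin m) (Fin m) ℝ))).IsSymm := by
    have hPs : Pᵀ = P := by simpa using hP.isHermitian.eq
    simp [Matrix.IsSymm, Matrix.fromBlocks_transpose, hPs]
  refine ⟨hH, Matrix.PosDef.of_dotProduct_mulVec_pos (by simpa [IsHermitian] using hH.eq) ?_⟩
  intro x hx
  obtain ⟨u, v, rfl⟩ : ∃ u v, x = Sum.elim u v :=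
    ⟨x ∘ Sum.inl, x ∘ Sum.inr, (Sum.elim_comp_inl_inr x).symm⟩
  have hsymm : u ⬝ᵥ (Hᵀ *ᵥ v) = v ⬝ᵥ (H *ᵥ u) := by
    rw [mulVec_transpose, dotProduct_comm, dotProduct_mulVec]
  have hform : star (Sum.elim u v) ⬝ᵥ
      (Matrix.fromBlocks ((1/α) • (1 : Matrix (Fin n) (Fin n) ℝ) - P) (-Hᵀ) (-H)
        ((1/β) • (1 : Matrix (Fin m) (Fin m) ℝ)) *ᵥ Sum.elim u v) =
      1 / α * (u ⬝ᵥ u) - u ⬝ᵥ (P *ᵥ u) - 2 * (v ⬝ᵥ (H *ᵥ u)) + 1 / β * (v ⬝ᵥ v) := by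
    simp only [star_trivial, fromBlocks_mulVec, Sum.elim_comp_inl, Sum.elim_comp_inr,
      sumElim_dotProduct_sumElim, sub_mulVec, neg_mulVec, smul_mulVec, one_mulVec,
      dotProduct_add, dotProduct_sub, dotProduct_neg, dotProduct_smul, smul_eq_mul, hsymm]
    ring
  have hPu := dotProduct_mulVec_le_specNorm P u u
  have hHu := dotProduct_mulVec_le_specNorm H v u
  have hgap : 0 < 1 / α - specNorm P - β * specNorm H ^ 2 := by
    have := (lt_div_iff₀' hα).mpr hstep
    linarith
  have huv : u ≠ 0 ∨ v ≠ 0 := by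
    by_contra! h
    exact hx (by rw [h.1, h.2]; ext (i | i) <;> rfl)
  rw [hform, dotProduct_self_eq_norm_sq, dotProduct_self_eq_norm_sq]
  set a := ‖WithLp.toLp 2 u‖ with ha
  set b := ‖WithLp.toLp 2 v‖
  have hsq : 1 / α * a ^ 2 - specNorm P * a * a - 2 * (specNorm H * a * b) + 1 / β * b ^ 2 =
      (1 / α - specNorm P - β * specNorm H ^ 2) * a ^ 2 + (β * specNorm H * a - b) ^ 2 / β := by
    field_simp
    ring
  have hpos : 0 < (1 / α - specNorm P - β * specNorm H ^ 2) * a ^ 2 +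
      (β * specNorm H * a - b) ^ 2 / β := by
    by_cases hu : u = 0
    · have ha₀ : a = 0 := by simp [ha, hu]
      have hb₀ : 0 < b := norm_pos_iff.mpr (by simpa using huv.resolve_left (not_not.mpr hu))
      rw [ha₀]
      simp only [mul_zero, zero_sub, ne_eq, OfNat.ofNat_ne_zero, not_false_eq_true, zero_pow,
        zero_add, even_two, Even.neg_pow]
      positivity
    · have ha₀ : 0 < a := norm_pos_iff.mpr (by simpa using hu)
      positivity
  linarith
end

section
/- Suppose α, β > 0, α(‖P‖ + β‖H‖²) < 1, and ρ ∈ (0, 2). Define T : ℝ^{n+m} → ℝ^{n+m} by T(ξ, η) = ((1−ρ)ξ + ρ z⁺, (1−ρ)η + ρ w⁺), where z⁺ = π_D[ξ − α(Pξ + q + Hᵀη)] and w⁺ = π_{K°}[η + β(H(2z⁺ − ξ) − g)]. Then T is a (ρ/2)-averaged operator with respect to the norm ‖·‖_M, i.e., for all ζ₁, ζ₂ ∈ ℝ^{n+m}: ‖T(ζ₁) − T(ζ₂)‖_M² − ‖ζ₁ − ζ₂‖_M² ≤ ((ρ/2 − 1)/(ρ/2)) ‖ζ₁ − ζ₂ −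 T(ζ₁) + T(ζ₂)‖_M². -/
open scoped RealInnerProductSpace
open Matrix

/-- The linear map on Euclidean space induced by a matrix (matrix-vector product). -/
noncomputable def mvec {ι κ : Type*} [Fintype ι] [Fintype κ] [DecidableEq κ]
    (A : Matrix ι κ ℝ) (x : EuclideanSpace ℝ κ) : EuclideanSpace ℝ ι :=
  Matrix.toEuclideanLin A x

open Classical in
/-- Projection onto a (nonempty closed convex) set: the minimizer of the distance to `x`. -/
noncomputable def proj {ι : Type*} [Fintype ι] (C : Set (EuclideanSpace ℝ ι))
    (x : EuclideanSpace ℝ ι) : EuclideanSpace ℝ ι :=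
  if h : ∃ y ∈ C, ∀ c ∈ C, ‖x - y‖ ≤ ‖x - c‖ then h.choose else x

/-- Polar cone `K° = {w | ⟨w, y⟩ ≤ 0 for all y ∈ K}`. -/
def polarCone {ι : Type*} [Fintype ι] (K : Set (EuclideanSpace ℝ ι)) :
    Set (EuclideanSpace ℝ ι) := {w | ∀ y ∈ K, ⟪w, y⟫ ≤ 0}

/-- A nonempty closed convex cone. -/
def IsClosedConvexCone {ι : Type*} [Fintype ι] (K : Set (EuclideanSpace ℝ ι)) : Prop :=
  IsClosed K ∧ Convex ℝ K ∧ ∀ w ∈ K, ∀ c : ℝ, 0 ≤ c → c • w ∈ K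

/-- Concatenation `(ξ, η) ↦ ζ` of two Euclidean vectors into `ℝ^{n+m}`. -/
noncomputable def join {ι κ : Type*} (x : EuclideanSpace ℝ ι) (y : EuclideanSpace ℝ κ) :
    EuclideanSpace ℝ (ι ⊕ κ) :=
  (WithLp.equiv 2 _).symm (Sum.elim ((WithLp.equiv 2 _) x) ((WithLp.equiv 2 _) y))

/-- First block of a vector in `ℝ^{n+m}`. -/
noncomputable def split₁ {ι κ : Type*} (ζ : EuclideanSpace ℝ (ι ⊕ κ)) : EuclideanSpace ℝ ι :=
  (WithLp.equiv 2 _).symm fun i => (WithLp.equiv 2 _) ζ (Sum.inl i)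

/-- Second block of a vector in `ℝ^{n+m}`. -/
noncomputable def split₂ {ι κ : Type*} (ζ : EuclideanSpace ℝ (ι ⊕ κ)) : EuclideanSpace ℝ κ :=
  (WithLp.equiv 2 _).symm fun i => (WithLp.equiv 2 _) ζ (Sum.inr i)

theorem proj_mem_and_inner_le_zero {ι : Type*} [Fintype ι] {C : Set (EuclideanSpace ℝ ι)}
    (hne : C.Nonempty) (hcl : IsClosed C) (hcv : Convex ℝ C) (x : EuclideanSpace ℝ ι) :
    proj C x ∈ C ∧ ∀ c ∈ C, ⟪x - proj C x, c - proj C x⟫ ≤ 0 := by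
  have hex : ∃ y ∈ C, ∀ c ∈ C, ‖x - y‖ ≤ ‖x - c‖ := by
    obtain ⟨y, hy, hmin⟩ := hcl.exists_infDist_eq_dist hne x
    refine ⟨y, hy, fun c hc => ?_⟩
    rw [← dist_eq_norm, ← dist_eq_norm, ← hmin]
    exact Metric.infDist_le_dist_of_mem hc
  have hproj : proj C x ∈ C ∧ ∀ c ∈ C, ‖x - proj C x‖ ≤ ‖x - c‖ := by
    rw [proj, dif_pos hex]
    exact hex.choose_spec
  refine ⟨hproj.1, (norm_eq_iInf_iff_real_inner_le_zero hcv hproj.1).1 ?_⟩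
  have : Nonempty C := hne.to_subtype
  refine le_antisymm (le_ciInf fun c => hproj.2 c c.2) (ciInf_le ⟨0, ?_⟩ (⟨_, hproj.1⟩ : C))
  rintro _ ⟨c, rfl⟩
  exact norm_nonneg _

theorem inner_proj_sub_nonneg {ι : Type*} [Fintype ι] {C : Set (EuclideanSpace ℝ ι)}
    (hne : C.Nonempty) (hcl : IsClosed C) (hcv : Convex ℝ C) (x y : EuclideanSpace ℝ ι) :
    0 ≤ ⟪proj C x - proj C y, (x - y) - (proj C x - proj C y)⟫ := by
  obtain ⟨hx, hx'⟩ := proj_mem_and_inner_le_zero hne hcl hcv x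
  obtain ⟨hy, hy'⟩ := proj_mem_and_inner_le_zero hne hcl hcv y
  have h₁ := hx' _ hy
  have h₂ := hy' _ hx
  rw [real_inner_comm]
  simp only [inner_sub_left, inner_sub_right] at *
  linarith

theorem zero_mem_polarCone {ι : Type*} [Fintype ι] (K : Set (EuclideanSpace ℝ ι)) :
    0 ∈ polarCone K := fun y _ => by simp

theorem isClosed_polarCone {ι : Type*} [Fintype ι] (K : Set (EuclideanSpace ℝ ι)) :
    IsClosed (polarCone K) := by
  simp only [polarCone, Set.ofPred_forall]
  exact isClosed_biInter fun y _ => isClosed_le (by fun_prop) continuous_const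

theorem convex_polarCone {ι : Type*} [Fintype ι] (K : Set (EuclideanSpace ℝ ι)) :
    Convex ℝ (polarCone K) := by
  intro u hu v hv a b ha hb _ y hy
  rw [inner_add_left, real_inner_smul_left, real_inner_smul_left]
  exact add_nonpos (mul_nonpos_of_nonneg_of_nonpos ha (hu y hy))
    (mul_nonpos_of_nonneg_of_nonpos hb (hv y hy))

section mvec

variable {ι κ : Type*} [Fintype ι] [Fintype κ] [DecidableEq κ]

theorem mvec_add (A : Matrix ι κ ℝ) (x y : EuclideanSpace ℝ κ) :
    mvec A (x + y) = mvec A x + mvec A y := map_add _ _ _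

theorem mvec_sub (A : Matrix ι κ ℝ) (x y : EuclideanSpace ℝ κ) :
    mvec A (x - y) = mvec A x - mvec A y := map_sub _ _ _

theorem mvec_smul (A : Matrix ι κ ℝ) (c : ℝ) (x : EuclideanSpace ℝ κ) :
    mvec A (c • x) = c • mvec A x := map_smul _ _ _

theorem inner_mvec (A : Matrix ι κ ℝ) (x : EuclideanSpace ℝ ι) (y : EuclideanSpace ℝ κ) :
    ⟪x, mvec A y⟫ = x.ofLp ⬝ᵥ A *ᵥ y.ofLp := by
  rw [mvec, EuclideanSpace.inner_eq_star_dotProduct, star_trivial, dotProduct_comm,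
    Matrix.ofLp_toLpLin, Matrix.toLin'_apply]

theorem inner_mvec_transpose [DecidableEq ι] (A : Matrix ι κ ℝ) (x : EuclideanSpace ℝ κ)
    (y : EuclideanSpace ℝ ι) : ⟪x, mvec Aᵀ y⟫ = ⟪y, mvec A x⟫ := by
  rw [inner_mvec, inner_mvec, mulVec_transpose, dotProduct_comm, dotProduct_mulVec]

theorem inner_mvec_fromBlocks [DecidableEq ι] (A : Matrix ι ι ℝ) (B : Matrix ι κ ℝ)
    (C : Matrix κ ι ℝ) (E : Matrix κ κ ℝ) (x y : EuclideanSpace ℝ (ι ⊕ κ)) :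
    ⟪x, mvec (fromBlocks A B C E) y⟫ =
      ⟪split₁ x, mvec A (split₁ y)⟫ + ⟪split₁ x, mvec B (split₂ y)⟫ +
        (⟪split₂ x, mvec C (split₁ y)⟫ + ⟪split₂ x, mvec E (split₂ y)⟫) := by
  simp only [inner_mvec, fromBlocks_mulVec, ← dotProduct_add]
  simp only [dotProduct, Fintype.sum_sum_type, Sum.elim_inl, Sum.elim_inr]
  rfl

end mvec

/-- Relaxing a map which is firmly nonexpansive for a symmetric bilinear form gives an averaged
map: here `u` and `u - d` are the differences of two points and of their images. -/
theorem inner_mvec_relaxation_le {ι : Type*} [Fintype ι] [DecidableEq ι] {M : Matrix ι ι ℝ}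
    (hM : Mᵀ = M) {ρ : ℝ} (hρ : 0 < ρ) {u d : EuclideanSpace ℝ ι}
    (h : 0 ≤ ⟪u - d, mvec M d⟫) :
    ⟪u - ρ • d, mvec M (u - ρ • d)⟫ - ⟪u, mvec M u⟫ ≤
      ((ρ / 2 - 1) / (ρ / 2)) * ⟪ρ • d, mvec M (ρ • d)⟫ := by
  have hsymm : ⟪d, mvec M u⟫ = ⟪u, mvec M d⟫ := by
    rw [← inner_mvec_transpose, hM]
  have hc : (ρ / 2 - 1) / (ρ / 2) * (ρ * (ρ * ⟪d, mvec M d⟫)) =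
      (ρ - 2) * (ρ * ⟪d, mvec M d⟫) := by
    field_simp
  simp only [mvec_sub, mvec_smul, inner_sub_left, inner_sub_right, real_inner_smul_left,
    real_inner_smul_right, hsymm] at h ⊢
  rw [hc]
  nlinarith [mul_nonneg hρ.le h]

/-- Under the step-size conditions `α, β > 0`, `α(‖P‖ + β‖H‖²) < 1` and
`ρ ∈ (0,2)`, the xPIPG map `T(ξ, η) = ((1−ρ)ξ + ρ z⁺, (1−ρ)η + ρ w⁺)`, where
`z⁺ = π_D[ξ − α(Pξ + q + Hᵀη)]` and `w⁺ = π_{K°}[η + β(H(2z⁺ − ξ) − g)]`, is a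
`(ρ/2)`-averaged operator with respect to the norm `‖·‖_M`, where
`M = [[(1/α)Iₙ − P, −Hᵀ], [−H, (1/β)Iₘ]]`. -/
theorem stmt1 {n m : ℕ} (P : Matrix (Fin n) (Fin n) ℝ) (q : EuclideanSpace ℝ (Fin n))
    (H : Matrix (Fin m) (Fin n) ℝ) (g : EuclideanSpace ℝ (Fin m))
    (D : Set (EuclideanSpace ℝ (Fin n))) (K : Set (EuclideanSpace ℝ (Fin m)))
    (hP : P.PosSemidef)
    (hDne : D.Nonempty) (hDcl : IsClosed D) (hDcv : Convex ℝ D)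
    (hKne : K.Nonempty) (hK : IsClosedConvexCone K)
    (α β ρ : ℝ) (hα : 0 < α) (hβ : 0 < β)
    (hstep : α * (specNorm P + β * specNorm H ^ 2) < 1) (hρ : ρ ∈ Set.Ioo (0 : ℝ) 2)
    (M : Matrix (Fin n ⊕ Fin m) (Fin n ⊕ Fin m) ℝ)
    (hM : M = Matrix.fromBlocks ((1/α) • (1 : Matrix (Fin n) (Fin n) ℝ) - P) (-Hᵀ) (-H)
      ((1/β) • (1 : Matrix (Fin m) (Fin m) ℝ)))
    (zp : EuclideanSpace ℝ (Fin n ⊕ Fin m) → EuclideanSpace ℝ (Fin n))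
    (wp : EuclideanSpace ℝ (Fin n ⊕ Fin m) → EuclideanSpace ℝ (Fin m))
    (hzp : ∀ ζ, zp ζ =
      proj D (split₁ ζ - α • (mvec P (split₁ ζ) + q + mvec Hᵀ (split₂ ζ))))
    (hwp : ∀ ζ, wp ζ =
      proj (polarCone K) (split₂ ζ + β • (mvec H ((2 : ℝ) • zp ζ - split₁ ζ) - g)))
    (T : EuclideanSpace ℝ (Fin n ⊕ Fin m) → EuclideanSpace ℝ (Fin n ⊕ Fin m))
    (hT : ∀ ζ, T ζ = join ((1 - ρ) • split₁ ζ + ρ • zp ζ) ((1 - ρ) • split₂ ζ + ρ • wp ζ)) :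
    ∀ ζ₁ ζ₂,
      ⟪T ζ₁ - T ζ₂, mvec M (T ζ₁ - T ζ₂)⟫ - ⟪ζ₁ - ζ₂, mvec M (ζ₁ - ζ₂)⟫ ≤
        ((ρ / 2 - 1) / (ρ / 2)) *
          ⟪ζ₁ - ζ₂ - T ζ₁ + T ζ₂, mvec M (ζ₁ - ζ₂ - T ζ₁ + T ζ₂)⟫ := by
  intro ζ₁ ζ₂
  have hPsymm : Pᵀ = P := by simpa using hP.isHermitian.eq
  have hMsymm : Mᵀ = M := by
    simp [hM, fromBlocks_transpose, hPsymm]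
  set v := join (zp ζ₁ - zp ζ₂) (wp ζ₁ - wp ζ₂) with hv
  have hTsub : T ζ₁ - T ζ₂ = (ζ₁ - ζ₂) - ρ • ((ζ₁ - ζ₂) - v) := by
    rw [hT, hT, hv]
    ext (i | i) <;> simp [join, split₁, split₂] <;> ring
  have hres : ζ₁ - ζ₂ - T ζ₁ + T ζ₂ = ρ • ((ζ₁ - ζ₂) - v) := by
    rw [sub_add, hTsub, sub_sub_cancel]
  rw [hres, hTsub]
  refine inner_mvec_relaxation_le hMsymm hρ.1 ?_
  rw [sub_sub_cancel, hM, inner_mvec_fromBlocks]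
  have hv₁ : split₁ v = zp ζ₁ - zp ζ₂ := rfl
  have hv₂ : split₂ v = wp ζ₁ - wp ζ₂ := rfl
  have hd₁ : split₁ (ζ₁ - ζ₂ - v) = split₁ ζ₁ - split₁ ζ₂ - (zp ζ₁ - zp ζ₂) := rfl
  have hd₂ : split₂ (ζ₁ - ζ₂ - v) = split₂ ζ₁ - split₂ ζ₂ - (wp ζ₁ - wp ζ₂) := rfl
  rw [hv₁, hv₂, hd₁, hd₂]
  have hz := inner_proj_sub_nonneg hDne hDcl hDcv
    (split₁ ζ₁ - α • (mvec P (split₁ ζ₁) + q + mvec Hᵀ (split₂ ζ₁)))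
    (split₁ ζ₂ - α • (mvec P (split₁ ζ₂) + q + mvec Hᵀ (split₂ ζ₂)))
  have hw := inner_proj_sub_nonneg ⟨0, zero_mem_polarCone K⟩ (isClosed_polarCone K)
    (convex_polarCone K)
    (split₂ ζ₁ + β • (mvec H ((2 : ℝ) • zp ζ₁ - split₁ ζ₁) - g))
    (split₂ ζ₂ + β • (mvec H ((2 : ℝ) • zp ζ₂ - split₁ ζ₂) - g))
  rw [← hzp, ← hzp] at hz
  rw [← hwp, ← hwp] at hw
  generalize zp ζ₁ = z₁ at *
  generalize zp ζ₂ = z₂ at *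
  generalize wp ζ₁ = w₁ at *
  generalize wp ζ₂ = w₂ at *
  generalize split₁ ζ₁ = ξ₁ at *
  generalize split₁ ζ₂ = ξ₂ at *
  generalize split₂ ζ₁ = η₁ at *
  generalize split₂ ζ₂ = η₂ at *
  have hPnonneg : 0 ≤ ⟪z₁ - z₂, mvec P (z₁ - z₂)⟫ := by
    rw [inner_mvec]
    simpa using hP.dotProduct_mulVec_nonneg (z₁ - z₂).ofLp
  have hadj : ⟪z₁ - z₂, mvec Hᵀ (w₁ - w₂)⟫ = ⟪w₁ - w₂, mvec H (z₁ - z₂)⟫ :=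
    inner_mvec_transpose _ _ _
  have ez : ξ₁ - α • (mvec P ξ₁ + q + mvec Hᵀ η₁) - (ξ₂ - α • (mvec P ξ₂ + q + mvec Hᵀ η₂))
      - (z₁ - z₂) = α • ((1 / α) • (ξ₁ - ξ₂ - (z₁ - z₂)) - mvec P (ξ₁ - ξ₂)
        - mvec Hᵀ (η₁ - η₂)) := by
    simp only [mvec_sub, smul_sub, smul_smul, mul_one_div_cancel hα.ne', one_smul, smul_add]
    abel
  have ew : η₁ + β • (mvec H ((2 : ℝ) • z₁ - ξ₁) - g) -
      (η₂ + β • (mvec H ((2 : ℝ) • z₂ - ξ₂) - g)) - (w₁ - w₂) =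
      β • ((1 / β) • (η₁ - η₂ - (w₁ - w₂)) + (2 : ℝ) • mvec H (z₁ - z₂) - mvec H (ξ₁ - ξ₂)) := by
    simp only [mvec_sub, mvec_smul, smul_sub, smul_smul, mul_one_div_cancel hβ.ne', one_smul,
      smul_add]
    abel
  rw [ez, real_inner_smul_right] at hz
  rw [ew, real_inner_smul_right] at hw
  have hz' := nonneg_of_mul_nonneg_right hz hα
  have hw' := nonneg_of_mul_nonneg_right hw hβ
  have hA : ∀ x, mvec ((1 / α) • (1 : Matrix (Fin n) (Fin n) ℝ) - P) x =
      (1 / α) • x - mvec P x := fun x => by simp [mvec]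
  have hB : ∀ y, mvec (-Hᵀ) y = -mvec Hᵀ y := fun y => by simp [mvec]
  have hC : ∀ x, mvec (-H) x = -mvec H x := fun x => by simp [mvec]
  have hE : ∀ y, mvec ((1 / β) • (1 : Matrix (Fin m) (Fin m) ℝ)) y = (1 / β) • y :=
    fun y => by simp [mvec]
  rw [hA, hB, hC, hE, mvec_sub P, mvec_sub Hᵀ (η₁ - η₂), mvec_sub H (ξ₁ - ξ₂)]
  generalize z₁ - z₂ = z at *
  generalize w₁ - w₂ = w at *
  generalize ξ₁ - ξ₂ = ξ at *
  generalize η₁ - η₂ = η at *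
  simp only [inner_sub_right, inner_add_right, inner_neg_right, real_inner_smul_right]
    at hz' hw' ⊢
  linarith
end

section
/- Let M be a symmetric positive definite p×p real matrix and let T : ℝ^p → ℝ^p be a γ-averaged operator for some γ ∈ (0, 1) with respect to ‖·‖_M, i.e., for all ζ₁, ζ₂: ‖T(ζ₁) − T(ζ₂)‖_M² − ‖ζ₁ − ζ₂‖_M² ≤ ((γ−1)/γ)‖ζ₁ − ζ₂ − T(ζ₁) + T(ζ₂)‖_M². Let ζ¹ ∈ ℝ^p and define ζ^{j+1} := T(ζ^j) for all j ∈ ℕ. Then there exists ζ̄ ∈ ℝ^p (the minimal-displacement vector of T) such that lim_{j→∞} ζ^j / j = lim_{j→∞} (ζ^{j+1} − ζ^j) = ζ̄. -/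
open scoped RealInnerProductSpace
open Filter Topology

section
variable {E : Type*} [NormedAddCommGroup E]

theorem norm_sub_add_le {x : ℕ → E}
    (hx : ∀ i j, ‖x (i + 1) - x (j + 1)‖ ≤ ‖x i - x j‖) (i j n : ℕ) :
    ‖x (i + n) - x (j + n)‖ ≤ ‖x i - x j‖ := by
  induction n with
  | zero => simp
  | succ n ih => exact (hx (i + n) (j + n)).trans ih

theorem norm_sub_le_nsmul {x : ℕ → E}
    (hx : ∀ i j, ‖x (i + 1) - x (j + 1)‖ ≤ ‖x i - x j‖) (N k : ℕ) :
    ‖x (N + k) - x N‖ ≤ k * ‖x (N + 1) - x N‖ := by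
  induction k with
  | zero => simp
  | succ k ih =>
    have h := norm_sub_add_le hx (N + 1) N k
    have e : x (N + (k + 1)) - x N = (x (N + 1 + k) - x (N + k)) + (x (N + k) - x N) := by
      rw [show N + (k + 1) = N + 1 + k by ring]; abel
    rw [e]
    push_cast
    linarith [norm_add_le (x (N + 1 + k) - x (N + k)) (x (N + k) - x N)]

variable [InnerProductSpace ℝ E]

theorem tendsto_sub_sub_nsmul {x : ℕ → E}
    (h : Tendsto (fun m ↦ (x (m + 1) - x m) - (x (m + 1 + 1) - x (m + 1))) atTop (𝓝 0)) (k : ℕ) :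
    Tendsto (fun m ↦ (x (m + k) - x m) - (k : ℝ) • (x (m + 1) - x m)) atTop (𝓝 0) := by
  have hD : ∀ k : ℕ, Tendsto (fun m ↦ (x (m + k + 1) - x (m + k)) - (x (m + 1) - x m))
      atTop (𝓝 0) := by
    intro k
    induction k with
    | zero => simp
    | succ k ih =>
      have := ih.sub (h.comp (tendsto_add_atTop_nat k))
      rw [sub_zero] at this
      refine this.congr fun m ↦ ?_
      simp only [Function.comp, ← add_assoc]
      abel
  induction k with
  | zero => simp
  | succ k ih =>
    have := ih.add (hD k)
    rw [add_zero] at this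
    refine this.congr fun m ↦ ?_
    push_cast
    rw [← add_assoc, add_smul, one_smul]
    abel

/-- A direction along which a nonexpansive orbit with escape rate at least `d` advances
at speed almost `d` up to an arbitrarily late time. -/
theorem exists_direction {x : ℕ → E}
    (hx : ∀ i j, ‖x (i + 1) - x (j + 1)‖ ≤ ‖x i - x j‖) {d : ℝ} (N : ℕ)
    (hd : ∀ k : ℕ, k * d ≤ ‖x (N + k) - x N‖) {ε : ℝ} (hε : 0 < ε) (K : ℕ) :
    ∃ f : E, ‖f‖ ≤ 1 ∧ ∀ k ≤ K, k * (d - ε) ≤ ⟪f, x (N + k) - x N⟫ := by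
  have hu : Tendsto (fun k : ℕ ↦ ‖x (N + k) - x N‖ - k * (d - ε)) atTop atTop := by
    refine tendsto_atTop_mono (fun k ↦ ?_) (tendsto_natCast_atTop_atTop.atTop_mul_const hε)
    linarith [hd k]
  obtain ⟨n, hn, hKn⟩ :=
    ((frequently_high_scores hu).and_eventually (eventually_ge_atTop K)).exists
  refine ⟨‖x (N + n) - x N‖⁻¹ • (x (N + n) - x N), ?_, fun k hk ↦ ?_⟩
  · rw [norm_smul, norm_inv, norm_norm]
    exact inv_mul_le_one
  · have hkn : k ≤ n := hk.trans hKn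
    have h1 : k * (d - ε) ≤ ‖x (N + n) - x N‖ - ‖x (N + n) - x (N + k)‖ := by
      have h2 := norm_sub_add_le hx (N + (n - k)) N k
      rw [show N + (n - k) + k = N + n by omega] at h2
      rcases Nat.eq_zero_or_pos k with rfl | hk0
      · simp
      · have h3 := hn (n - k) (by omega)
        rw [Nat.cast_sub hkn] at h3
        linarith
    refine h1.trans ?_
    rw [real_inner_smul_left]
    rcases (norm_nonneg (x (N + n) - x N)).eq_or_lt with h0 | h0
    · rw [← h0]; simp
    · rw [le_inv_mul_iff₀ h0]
      have e : x (N + k) - x N = (x (N + n) - x N) - (x (N + n) - x (N + k)) := by abel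
      rw [e, inner_sub_right, real_inner_self_eq_norm_sq]
      nlinarith [real_inner_le_norm (x (N + n) - x N) (x (N + n) - x (N + k))]

theorem norm_sub_mean_le {x : ℕ → E}
    (hx : ∀ i j, ‖x (i + 1) - x (j + 1)‖ ≤ ‖x i - x j‖) {d : ℝ} (hd0 : 0 ≤ d) (N : ℕ)
    (hd : ∀ k : ℕ, k * d ≤ ‖x (N + k) - x N‖) {l : ℕ} (hl : 1 ≤ l) :
    ‖(x (N + 1) - x N) - (l : ℝ)⁻¹ • (x (N + l) - x N)‖ ≤
      2 * √(‖x (N + 1) - x N‖ ^ 2 - d ^ 2) := by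
  have key : ∀ ε > 0, ‖(x (N + 1) - x N) - (l : ℝ)⁻¹ • (x (N + l) - x N)‖ ≤
      2 * √(‖x (N + 1) - x N‖ ^ 2 - d ^ 2 + 2 * d * ε) := by
    intro ε hε
    obtain ⟨f, hf, hfk⟩ := exists_direction hx N hd hε l
    have hy : ∀ k : ℕ, 1 ≤ k → k ≤ l → ‖(k : ℝ)⁻¹ • (x (N + k) - x N) - d • f‖ ≤
        √(‖x (N + 1) - x N‖ ^ 2 - d ^ 2 + 2 * d * ε) := by
      intro k hk hkl
      have hk0 : (0 : ℝ) < k := by exact_mod_cast hk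
      have h1 : d - ε ≤ ⟪(k : ℝ)⁻¹ • (x (N + k) - x N), f⟫ := by
        rw [real_inner_smul_left, real_inner_comm, le_inv_mul_iff₀ hk0]
        exact hfk k hkl
      have h2 : ‖(k : ℝ)⁻¹ • (x (N + k) - x N)‖ ≤ ‖x (N + 1) - x N‖ := by
        rw [norm_smul, norm_inv, Real.norm_natCast, inv_mul_le_iff₀ hk0]
        exact norm_sub_le_nsmul hx N k
      apply Real.le_sqrt_of_sq_le
      rw [norm_sub_sq_real, real_inner_smul_right, norm_smul d f, Real.norm_of_nonneg hd0]
      have h3 := mul_le_mul_of_nonneg_left h1 hd0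
      have h4 : d * ‖f‖ ≤ d := mul_le_of_le_one_right hd0 hf
      have h5 := pow_le_pow_left₀ (by positivity) h4 2
      have h6 := pow_le_pow_left₀ (norm_nonneg _) h2 2
      linarith
    have h1 := hy 1 le_rfl hl
    have h2 := hy l hl le_rfl
    rw [Nat.cast_one, inv_one, one_smul] at h1
    have h3 := norm_sub_le_norm_sub_add_norm_sub (x (N + 1) - x N) (d • f)
      ((l : ℝ)⁻¹ • (x (N + l) - x N))
    rw [norm_sub_rev (d • f)] at h3
    linarith
  have hlim : Tendsto (fun ε : ℝ ↦ 2 * √(‖x (N + 1) - x N‖ ^ 2 - d ^ 2 + 2 * d * ε)) (𝓝[>] 0)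
      (𝓝 (2 * √(‖x (N + 1) - x N‖ ^ 2 - d ^ 2 + 2 * d * 0))) :=
    Continuous.tendsto' (by fun_prop) _ _ rfl |>.mono_left nhdsWithin_le_nhds
  rw [mul_zero, add_zero] at hlim
  exact ge_of_tendsto hlim (eventually_mem_nhdsWithin.mono key)

/-- The mean displacements and the successive displacements along an orbit of an averaged
operator converge to a common limit. -/
theorem exists_tendsto_displacement [CompleteSpace E] {x : ℕ → E} {c : ℝ} (hc : 0 < c)
    (h : ∀ i j, ‖x (i + 1) - x (j + 1)‖ ^ 2 ≤
      ‖x i - x j‖ ^ 2 - c * ‖(x i - x j) - (x (i + 1) - x (j + 1))‖ ^ 2) :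
    ∃ v : E, Tendsto (fun n : ℕ ↦ (n : ℝ)⁻¹ • x n) atTop (𝓝 v) ∧
      Tendsto (fun n ↦ x (n + 1) - x n) atTop (𝓝 v) := by
  have hx : ∀ i j, ‖x (i + 1) - x (j + 1)‖ ≤ ‖x i - x j‖ := fun i j ↦
    le_of_sq_le_sq (by nlinarith [h i j, sq_nonneg ‖(x i - x j) - (x (i + 1) - x (j + 1))‖])
      (norm_nonneg _)
  have hanti : Antitone fun n ↦ ‖x (n + 1) - x n‖ := antitone_nat_of_succ_le fun n ↦ hx (n + 1) n
  obtain ⟨d, hd⟩ : ∃ d, Tendsto (fun n ↦ ‖x (n + 1) - x n‖) atTop (𝓝 d) :=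
    ⟨_, tendsto_atTop_ciInf hanti ⟨0, by rintro _ ⟨n, rfl⟩; exact norm_nonneg _⟩⟩
  have hd0 : 0 ≤ d := ge_of_tendsto' hd fun _ ↦ norm_nonneg _
  have hdiff : Tendsto (fun m ↦ (x (m + 1) - x m) - (x (m + 1 + 1) - x (m + 1))) atTop (𝓝 0) := by
    rw [tendsto_zero_iff_norm_tendsto_zero]
    have h1 : Tendsto (fun n ↦ √(c⁻¹ * (‖x (n + 1) - x n‖ ^ 2 - ‖x (n + 1 + 1) - x (n + 1)‖ ^ 2)))
        atTop (𝓝 √(c⁻¹ * (d ^ 2 - d ^ 2))) :=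
      (((hd.pow 2).sub ((hd.comp (tendsto_add_atTop_nat 1)).pow 2)).const_mul _).sqrt
    rw [sub_self, mul_zero, Real.sqrt_zero] at h1
    refine squeeze_zero (fun _ ↦ norm_nonneg _) (fun n ↦ Real.le_sqrt_of_sq_le ?_) h1
    rw [le_inv_mul_iff₀ hc]
    linarith [h (n + 1) n]
  have hlow : ∀ N k : ℕ, k * d ≤ ‖x (N + k) - x N‖ := by
    intro N k
    have h1 := (tendsto_sub_sub_nsmul hdiff k).norm
    rw [norm_zero] at h1
    have h2 := (hd.const_mul (k : ℝ)).sub h1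
    rw [sub_zero] at h2
    refine le_of_tendsto h2 ((eventually_ge_atTop N).mono fun m hm ↦ ?_)
    obtain ⟨t, rfl⟩ := Nat.exists_eq_add_of_le hm
    have h3 := norm_sub_add_le hx (N + k) N t
    rw [show N + k + t = N + t + k by ring] at h3
    have h4 := norm_sub_norm_le ((k : ℝ) • (x (N + t + 1) - x (N + t)))
      (x (N + t + k) - x (N + t))
    rw [norm_sub_rev (_ • _), norm_smul, Real.norm_natCast] at h4
    linarith
  set δ : ℕ → ℝ := fun N ↦ 2 * √(‖x (N + 1) - x N‖ ^ 2 - d ^ 2) with hδ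
  have hδ0 : Tendsto δ atTop (𝓝 0) := by
    have := (((hd.pow 2).sub_const (d ^ 2)).sqrt).const_mul 2
    simpa using this
  have hmean : ∀ N l : ℕ, 1 ≤ l →
      ‖(x (N + 1) - x N) - (l : ℝ)⁻¹ • (x (N + l) - x N)‖ ≤ δ N := fun N l hl ↦
    norm_sub_mean_le hx hd0 N (hlow N) hl
  have hshift : ∀ N : ℕ, Tendsto (fun l : ℕ ↦ (l : ℝ)⁻¹ • (x (N + l) - x N) - (l : ℝ)⁻¹ • x l)
      atTop (𝓝 0) := by
    intro N
    have h1 : Tendsto (fun l : ℕ ↦ (l : ℝ)⁻¹ * (‖x N - x 0‖ + ‖x N‖)) atTop (𝓝 0) := by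
      simpa using (tendsto_inv_atTop_nhds_zero_nat (𝕜 := ℝ)).mul_const (‖x N - x 0‖ + ‖x N‖)
    refine squeeze_zero_norm (fun l ↦ ?_) h1
    rw [← smul_sub, norm_smul, norm_inv, Real.norm_natCast]
    gcongr
    have h2 := norm_sub_add_le hx N 0 l
    rw [zero_add] at h2
    rw [show x (N + l) - x N - x l = (x (N + l) - x l) - x N by abel]
    exact (norm_sub_le _ _).trans (by gcongr)
  have hnear : ∀ N : ℕ, ∀ ε > 0, ∀ᶠ l : ℕ in atTop,
      ‖(x (N + 1) - x N) - (l : ℝ)⁻¹ • x l‖ < δ N + ε := by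
    intro N ε hε
    have h1 := (hshift N).norm
    rw [norm_zero] at h1
    filter_upwards [h1.eventually_lt_const hε, eventually_ge_atTop 1] with l hl hl1
    have h2 := norm_sub_le_norm_sub_add_norm_sub (x (N + 1) - x N)
      ((l : ℝ)⁻¹ • (x (N + l) - x N)) ((l : ℝ)⁻¹ • x l)
    linarith [hmean N l hl1]
  have hcauchy : CauchySeq fun l : ℕ ↦ (l : ℝ)⁻¹ • x l := by
    rw [Metric.cauchySeq_iff]
    intro ε hε
    obtain ⟨N, hN⟩ := (hδ0.eventually_lt_const (show (0 : ℝ) < ε / 4 by positivity)).exists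
    obtain ⟨L, hL⟩ := eventually_atTop.1 (hnear N (ε / 4) (by positivity))
    refine ⟨L, fun m hm n hn ↦ ?_⟩
    rw [dist_eq_norm]
    have h1 := norm_sub_le_norm_sub_add_norm_sub ((m : ℝ)⁻¹ • x m) (x (N + 1) - x N)
      ((n : ℝ)⁻¹ • x n)
    rw [norm_sub_rev ((m : ℝ)⁻¹ • x m) (x (N + 1) - x N)] at h1
    linarith [hL m hm, hL n hn]
  obtain ⟨v, hv⟩ := cauchySeq_tendsto_of_complete hcauchy
  refine ⟨v, hv, ?_⟩
  rw [tendsto_iff_norm_sub_tendsto_zero]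
  refine squeeze_zero (fun _ ↦ norm_nonneg _) (fun N ↦ ?_) hδ0
  refine le_of_forall_pos_le_add fun ε hε ↦ ?_
  exact le_of_tendsto (hv.const_sub _).norm ((hnear N ε hε).mono fun _ ↦ le_of_lt)

end

open scoped MatrixOrder in
theorem exists_equiv_inner_mvec {ι : Type*} [Fintype ι] [DecidableEq ι] {M : Matrix ι ι ℝ}
    (hM : M.PosDef) : ∃ L : EuclideanSpace ℝ ι ≃L[ℝ] EuclideanSpace ℝ ι,
      ∀ u, ⟪u, mvec M u⟫ = ‖L u‖ ^ 2 := by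
  have hpos : ∀ u : EuclideanSpace ℝ ι, u ≠ 0 → 0 < ⟪u, mvec M u⟫ := by
    intro u hu
    have := hM.dotProduct_mulVec_pos (x := u.ofLp) (by simpa using hu)
    simpa [mvec, EuclideanSpace.inner_eq_star_dotProduct, Matrix.toLpLin_apply,
      dotProduct_comm] using this
  obtain ⟨B, hB⟩ := CStarAlgebra.nonneg_iff_eq_star_mul_self.1
    (Matrix.nonneg_iff_posSemidef.2 hM.posSemidef)
  have hL : ∀ u, ⟪u, mvec M u⟫ = ‖Matrix.toEuclideanLin B u‖ ^ 2 := by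
    intro u
    rw [← real_inner_self_eq_norm_sq, ← LinearMap.adjoint_inner_right,
      ← Matrix.toEuclideanLin_conjTranspose_eq_adjoint, mvec, hB]
    simp [Matrix.toLpLin_apply, Matrix.star_eq_conjTranspose]
  refine ⟨(LinearEquiv.ofInjectiveEndo (Matrix.toEuclideanLin B)
    (LinearMap.ker_eq_bot.1 (LinearMap.ker_eq_bot'.2 fun u hu ↦ ?_))).toContinuousLinearEquiv, hL⟩
  by_contra h0
  have := hpos u h0
  rw [hL, hu] at this
  simp at this

/-- Let `M` be a symmetric positive definite `p × p` matrix and let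
`T` be a `γ`-averaged operator (for some `γ ∈ (0,1)`) with respect to the `M`-norm
`‖u‖_M² = ⟨u, M u⟩`.  If `ζ¹ ∈ ℝ^p` and `ζ^{j+1} = T(ζ^j)` for all `j ≥ 1`, then there is a
vector `ζ̄` (the minimal-displacement vector of `T`) with
`lim_{j→∞} ζ^j / j = lim_{j→∞} (ζ^{j+1} − ζ^j) = ζ̄`. -/
theorem stmt5 {p : ℕ} (M : Matrix (Fin p) (Fin p) ℝ) (hM : M.PosDef)
    (γ : ℝ) (hγ : γ ∈ Set.Ioo (0 : ℝ) 1)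
    (T : EuclideanSpace ℝ (Fin p) → EuclideanSpace ℝ (Fin p))
    (hT : ∀ ζ₁ ζ₂,
      ⟪T ζ₁ - T ζ₂, mvec M (T ζ₁ - T ζ₂)⟫ - ⟪ζ₁ - ζ₂, mvec M (ζ₁ - ζ₂)⟫ ≤
        ((γ - 1) / γ) * ⟪ζ₁ - ζ₂ - T ζ₁ + T ζ₂, mvec M (ζ₁ - ζ₂ - T ζ₁ + T ζ₂)⟫)
    (ζ : ℕ → EuclideanSpace ℝ (Fin p))
    (hζ : ∀ j, 1 ≤ j → ζ (j + 1) = T (ζ j)) :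
    ∃ ζbar : EuclideanSpace ℝ (Fin p),
      Tendsto (fun j : ℕ => (j : ℝ)⁻¹ • ζ j) atTop (𝓝 ζbar) ∧
      Tendsto (fun j : ℕ => ζ (j + 1) - ζ j) atTop (𝓝 ζbar) := by
  obtain ⟨L, hL⟩ := exists_equiv_inner_mvec hM
  have hc : 0 < (1 - γ) / γ := div_pos (sub_pos.2 hγ.2) hγ.1
  obtain ⟨v, hv, hv'⟩ := exists_tendsto_displacement (x := fun n ↦ L (ζ (n + 1))) hc (by
    intro i j
    have h := hT (ζ (i + 1)) (ζ (j + 1))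
    rw [← hζ (i + 1) (by omega), ← hζ (j + 1) (by omega), sub_add] at h
    simp only [hL, map_sub] at h
    rw [← neg_sub 1 γ, neg_div] at h
    linarith)
  have hmean := (L.symm.continuous.tendsto v).comp hv
  have hstep := (L.symm.continuous.tendsto v).comp hv'
  simp only [Function.comp_def, map_smul, map_sub, L.symm_apply_apply] at hmean hstep
  refine ⟨L.symm v, (tendsto_add_atTop_iff_nat 1).1 ?_, (tendsto_add_atTop_iff_nat 1).1 hstep⟩
  have h1 := (tendsto_natCast_div_add_atTop (𝕜 := ℝ) 1).smul hmean
  rw [one_smul] at h1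
  refine h1.congr' ((eventually_ne_atTop 0).mono fun n hn ↦ ?_)
  have hn' : (n : ℝ) ≠ 0 := by exact_mod_cast hn
  rw [smul_smul]
  congr 1
  push_cast
  field_simp
end
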